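/- Let K be the n×n matrix with entries K_{st} = min(s,t) − 1 (1-based indexing). Then for every n×n complex matrix M, the Hadamard product satisfies ‖K ∘ M‖ ≤ (n−1)‖M‖ in spectral norm. -/

import Mathlib

open Matrix
open scoped ComplexOrder

/-- Spectral (operator ℓ²→ℓ²) norm of a complex square matrix. -/
noncomputable def specNorm {n : ℕ} (M : Matrix (Fin n) (Fin n) ℂ) : ℝ :=
  ‖Matrix.toEuclideanCLM (𝕜 := ℂ) (n := Fin n) M‖

/-- Strictly lower triangular part of a matrix. -/
def lowerTri {n : ℕ} (M : Matrix (Fin n) (Fin n) ℂ) : Matrix (Fin n) (Fin n) ℂ :=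
  Matrix.of fun i j => if j < i then M i j else 0

/-- Squared energy seminorm |y|_B² = ⟨By, y⟩. -/
noncomputable def energySq {n : ℕ} (B : Matrix (Fin n) (Fin n) ℂ) (y : Fin n → ℂ) : ℝ :=
  (star y ⬝ᵥ (B *ᵥ y)).re

/-- Euclidean norm of a vector in ℂⁿ. -/
noncomputable def euclNorm {n : ℕ} (v : Fin n → ℂ) : ℝ :=
  ‖(WithLp.equiv 2 (Fin n → ℂ)).symm v‖

/-- Coordinate projection onto the indices larger than `k`. -/
def upperProj (n k : ℕ) : Matrix (Fin n) (Fin n) ℂ :=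
  Matrix.diagonal fun s => if k < s.val then 1 else 0

section

open scoped Matrix.Norms.L2Operator

lemma norm_upperProj_le_one (n k : ℕ) : ‖upperProj n k‖ ≤ 1 := by
  rw [upperProj, Matrix.l2_opNorm_diagonal]
  refine (pi_norm_le_iff_of_nonneg zero_le_one).2 fun s => ?_
  split_ifs <;> simp

lemma specNorm_eq_norm {n : ℕ} (M : Matrix (Fin n) (Fin n) ℂ) : specNorm M = ‖M‖ :=
  Matrix.l2_opNorm_toEuclideanCLM M

/-- Hadamard multiplication by `min s t` is a sum of `n - 1` compressions. -/
lemma hadamard_min_eq_sum {n : ℕ} (M : Matrix (Fin n) (Fin n) ℂ) :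
    Matrix.hadamard (Matrix.of fun s t : Fin n => ((min s.val t.val : ℕ) : ℂ)) M
      = ∑ k ∈ Finset.range (n - 1), upperProj n k * M * upperProj n k := by
  ext s t
  have hfilter : (Finset.range (n - 1)).filter (fun k => k < s.val ∧ k < t.val)
      = Finset.range (min s.val t.val) := by
    ext k
    simp only [Finset.mem_filter, Finset.mem_range]
    omega
  have hterm (k : ℕ) : (upperProj n k * M * upperProj n k) s t
      = if k < s.val ∧ k < t.val then M s t else 0 := by
    rw [upperProj, Matrix.mul_diagonal, Matrix.diagonal_mul]
    split_ifs <;> simp_all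
  rw [Matrix.sum_apply, Finset.sum_congr rfl fun k _ => hterm k, ← Finset.sum_filter, hfilter]
  simp [Matrix.hadamard_apply]

lemma norm_compression_le {n : ℕ} (k : ℕ) (M : Matrix (Fin n) (Fin n) ℂ) :
    ‖upperProj n k * M * upperProj n k‖ ≤ ‖M‖ :=
  calc ‖upperProj n k * M * upperProj n k‖
      ≤ ‖upperProj n k‖ * ‖M‖ * ‖upperProj n k‖ := norm_mul₃_le
    _ ≤ 1 * ‖M‖ * 1 := by gcongr <;> exact norm_upperProj_le_one n k
    _ = ‖M‖ := by ring

lemma specNorm_hadamard_min_le {n : ℕ} (M : Matrix (Fin n) (Fin n) ℂ) :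
    specNorm (Matrix.hadamard
        (Matrix.of fun s t : Fin n => ((min s.val t.val : ℕ) : ℂ)) M)
      ≤ ((n - 1 : ℕ) : ℝ) * specNorm M := by
  rw [specNorm_eq_norm, specNorm_eq_norm, hadamard_min_eq_sum]
  refine (norm_sum_le_of_le _ fun k _ => norm_compression_le k M).trans_eq ?_
  simp

end

/-- Hadamard multiplier bound for the matrix K with entries min(s,t)−1
(0-based: `min s t`): ‖K ∘ M‖ ≤ (n−1)‖M‖. -/
theorem hadamard_K_specNorm_le {n : ℕ} (M : Matrix (Fin n) (Fin n) ℂ) :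
    specNorm (Matrix.hadamard
        (Matrix.of fun s t : Fin n => ((min s.val t.val : ℕ) : ℂ)) M)
      ≤ ((n : ℝ) - 1) * specNorm M := by
  rcases n with _ | n
  · have hzero (A : Matrix (Fin 0) (Fin 0) ℂ) : specNorm A = 0 := by
      rw [Subsingleton.elim A 0]
      simp [specNorm]
    simp [hzero]
  · simpa using specNorm_hadamard_min_le M
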